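/- Let (X,d) be a totally split-decomposable metric space with integer-valued metric satisfying the local rank condition, and let (S,α) be the associated split system pair (S the set of all d-splits, α_S the isolation indices). Then the map κ restricted to T̄(S,α) is surjective onto E(X,d): every f ∈ E(X,d) equals κ(μ) for some μ ∈ T̄(S,α). -/

import Mathlib

open Set Function

noncomputable section

variable {X : Type*}

/-- `d` is a pseudometric on `X`. -/
def IsPseudometric (d : X → X → ℝ) : Prop :=
  (∀ x, d x x = 0) ∧ (∀ x y, d x y = d y x) ∧ ∀ x y z, d x z ≤ d x y + d y z

/-- `d` is a metric on `X`. -/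
def IsMetric (d : X → X → ℝ) : Prop :=
  IsPseudometric d ∧ ∀ x y, d x y = 0 → x = y

/-- `d` is integer-valued. -/
def IsIntegerValued (d : X → X → ℝ) : Prop := ∀ x y, ∃ n : ℤ, d x y = (n : ℝ)

/-- The quantity `β^d` associated to the four points `a, a', b, b'`. -/
def betaIdx (d : X → X → ℝ) (a a' b b' : X) : ℝ :=
  (max (max (d a b + d a' b') (d a' b + d a b')) (d a a' + d b b') - d a a' - d b b') / 2

/-- The isolation index `α^d_{{A,B}}` of the pair `{A,B}`. -/
def isolIdx (d : X → X → ℝ) (A B : Set X) : ℝ :=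
  sInf {r : ℝ | ∃ a ∈ A, ∃ a' ∈ A, ∃ b ∈ B, ∃ b' ∈ B, r = betaIdx d a a' b b'}

/-- `{A, B}` is a partial split of `X`. -/
def IsPartialSplit (A B : Set X) : Prop := A.Nonempty ∧ B.Nonempty ∧ Disjoint A B

/-- `{A, B}` is a split of `X`. -/
def IsSplit (A B : Set X) : Prop := IsPartialSplit A B ∧ A ∪ B = univ

/-- `{A, B}` is a `d`-split of `X`. -/
def IsDSplit (d : X → X → ℝ) (A B : Set X) : Prop := IsSplit A B ∧ 0 < isolIdx d A B

open Classical in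
/-- The split pseudometric `δ_S` of the split `{A, Aᶜ}`. -/
def splitDist (A : Set X) (x y : X) : ℝ := if x ∈ A ↔ y ∈ A then 0 else 1

/-- `Δ(X, ρ)`: functions with `f x + f y ≥ ρ x y` for all `x, y`. -/
def DeltaSet (ρ : X → X → ℝ) : Set (X → ℝ) := {f | ∀ x y, ρ x y ≤ f x + f y}

/-- Isbell's injective hull `E(X, d)`: the extremal functions, i.e. those with
`f x = sup_y (d x y - f y)` for every `x`. -/
def ExtSet (d : X → X → ℝ) : Set (X → ℝ) :=
  {f | ∀ x, IsLUB {r : ℝ | ∃ y, r = d x y - f y} (f x)}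

/-- `E'(X, d)`: elements of `Δ(X, d)` such that every point lies in some pair of `A(f)`. -/
def ExtSet' (d : X → X → ℝ) : Set (X → ℝ) :=
  {f | f ∈ DeltaSet d ∧ ∀ x, ∃ y, f x + f y = d x y}

/-- The set `A(f)` of (ordered) pairs where equality holds. -/
def eqSet (d : X → X → ℝ) (f : X → ℝ) : Set (X × X) := {p | f p.1 + f p.2 = d p.1 p.2}

/-- The direction space of the affine subspace `H(A)`; its dimension is `rank A`. -/
def dirSubmodule (A : Set (X × X)) : Submodule ℝ (X → ℝ) where
  carrier := {h | ∀ p ∈ A, h p.1 + h p.2 = 0}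
  add_mem' := by
    intro a b ha hb p hp
    have h1 := ha p hp
    have h2 := hb p hp
    simp only [Pi.add_apply]
    linarith
  zero_mem' := by intro p _; simp
  smul_mem' := by
    intro c a ha p hp
    have h1 := ha p hp
    simp only [Pi.smul_apply, smul_eq_mul]
    linear_combination c * h1

/-- The local rank condition. -/
def LRC (d : X → X → ℝ) : Prop :=
  ∀ f ∈ ExtSet d, ∃ ε : ℝ, 0 < ε ∧ ∃ N : ℕ,
    ∀ g ∈ ExtSet' d, (∀ x, |f x - g x| < ε) →
      Module.rank ℝ (dirSubmodule (eqSet d g)) ≤ (N : Cardinal)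

/-- `d` is totally split-decomposable: `d = ∑_{S a d-split} α_S δ_S`, where each
separating `d`-split `{A, Aᶜ}` is counted once via its part `A` containing `x`. -/
def TSD (d : X → X → ℝ) : Prop :=
  ∀ x y, d x y = ∑ᶠ A ∈ {A : Set X | IsDSplit d A Aᶜ ∧ x ∈ A ∧ y ∉ A}, isolIdx d A Aᶜ

/-- The cell `[f]` of `f ∈ E(X,d)`: all `g ∈ Δ(X,d)` with `A(f) ⊆ A(g)`. -/
def cellOf (d : X → X → ℝ) (f : X → ℝ) : Set (X → ℝ) :=
  {g | g ∈ DeltaSet d ∧ ∀ x y, f x + f y = d x y → g x + g y = d x y}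

open scoped ENNReal

/-- The support of `μ : U(S) → [0,∞)`, within the set `𝒮` of parts of splits. -/
def suppOf (𝒮 : Set (Set X)) (μ : Set X → ℝ) : Set (Set X) := {A ∈ 𝒮 | 0 < μ A}

/-- Membership in the hypercube `H(S, α)`. -/
def memH (𝒮 : Set (Set X)) (α : Set X → ℝ) (μ : Set X → ℝ) : Prop :=
  (∀ A ∈ 𝒮, 0 ≤ μ A) ∧ ∀ A ∈ 𝒮, μ A + μ Aᶜ = α A / 2

/-- Membership in `T̄(S, α)`. -/
def memT (𝒮 : Set (Set X)) (α : Set X → ℝ) (μ : Set X → ℝ) : Prop :=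
  memH 𝒮 α μ ∧ ∀ I : Set (Set X), I ⊆ suppOf 𝒮 μ → ⋃₀ I = univ → ⋂₀ I = ∅

/-- Membership in the Buneman complex `B(S, α)`. -/
def memB (𝒮 : Set (Set X)) (α : Set X → ℝ) (μ : Set X → ℝ) : Prop :=
  memH 𝒮 α μ ∧ ∀ A ∈ suppOf 𝒮 μ, ∀ B ∈ suppOf 𝒮 μ, A ∪ B = univ → A ∩ B = ∅

open Classical in
/-- The canonical point `φ_x ∈ H(S, α)`. -/
def phiPoint (α : Set X → ℝ) (x : X) : Set X → ℝ :=
  fun A => if x ∈ A then 0 else α A / 2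

/-- The `ℓ¹`-distance `d₁(μ, ψ) = ∑_{A ∈ U(S)} |μ A - ψ A|`, valued in `[0,∞]`. -/
def dOne (𝒮 : Set (Set X)) (μ ψ : Set X → ℝ) : ℝ≥0∞ :=
  ∑' A : 𝒮, ENNReal.ofReal |μ ↑A - ψ ↑A|

/-- Membership in the cell `[φ]` of `H(S, α)`. -/
def memCell (𝒮 : Set (Set X)) (α : Set X → ℝ) (φ μ : Set X → ℝ) : Prop :=
  memH 𝒮 α μ ∧ suppOf 𝒮 μ ⊆ suppOf 𝒮 φ

open Classical in
/-- The gate `γ^x_{[φ]}` of `φ_x` in the cell `[φ]`. -/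
def gateAt (𝒮 : Set (Set X)) (α : Set X → ℝ) (φ : Set X → ℝ) (x : X) : Set X → ℝ :=
  fun A => if A ∈ 𝒮 ∧ 0 < φ A ∧ 0 < φ Aᶜ then phiPoint α x A else φ A

section Decomposition

open Classical in
/-- The function equal to `t A` on `A` and to `w A - t A` off `A`. -/
def splitFun (w t : Set X → ℝ) (x : X) (A : Set X) : ℝ := if x ∈ A then t A else w A - t A

theorem splitDist_comm (A : Set X) (x y : X) : splitDist A x y = splitDist A y x := by
  by_cases hx : x ∈ A <;> by_cases hy : y ∈ A <;> simp [splitDist, hx, hy]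

/-- Weighted split systems with weights `w` in which no three splits of positive weight induce the
three different `2|2`-splits on some four points. -/
def IsWeaklyCompatible (w : Set X → ℝ) : Prop :=
  ∀ A B C : Set X, 0 < w A → 0 < w B → 0 < w C → ∀ x x' y y' : X,
    (x ∈ A ∧ x' ∈ A ∧ y ∉ A ∧ y' ∉ A) →
    ((x ∈ B ↔ y ∈ B) ∧ (x' ∈ B ↔ y' ∈ B) ∧ ¬(x ∈ B ↔ x' ∈ B)) →
    ((x ∈ C ↔ y' ∈ C) ∧ (x' ∈ C ↔ y ∈ C) ∧ ¬(x ∈ C ↔ x' ∈ C)) → False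

theorem splitDist_add_le (B : Set X) (x x' y y' : X)
    (h : ¬((x ∈ B ↔ y ∈ B) ∧ (x' ∈ B ↔ y' ∈ B) ∧ ¬(x ∈ B ↔ x' ∈ B))) :
    splitDist B x x' + splitDist B y y' ≤ splitDist B x y + splitDist B x' y' := by
  by_cases h1 : x ∈ B <;> by_cases h2 : x' ∈ B <;> by_cases h3 : y ∈ B <;>
    by_cases h4 : y' ∈ B <;> simp_all [splitDist]

theorem two_mul_le_of_not_crossing {w : Set X → ℝ} (hw : ∀ A, 0 ≤ w A) (F : Finset (Set X))
    {A : Set X} (hA : A ∈ F) {x x' y y' : X} (hx : x ∈ A) (hx' : x' ∈ A) (hy : y ∉ A)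
    (hy' : y' ∉ A)
    (h : ∀ B ∈ F, 0 < w B → ¬((x ∈ B ↔ y ∈ B) ∧ (x' ∈ B ↔ y' ∈ B) ∧ ¬(x ∈ B ↔ x' ∈ B))) :
    2 * w A + (∑ B ∈ F, w B * splitDist B x x' + ∑ B ∈ F, w B * splitDist B y y') ≤
      ∑ B ∈ F, w B * splitDist B x y + ∑ B ∈ F, w B * splitDist B x' y' := by
  have key : ∀ B ∈ F, 0 ≤ w B * (splitDist B x y + splitDist B x' y'
      - splitDist B x x' - splitDist B y y') := by
    intro B hB
    rcases (hw B).eq_or_lt with h0 | h0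
    · simp [← h0]
    · have := splitDist_add_le B x x' y y' (h B hB h0)
      exact mul_nonneg h0.le (by linarith)
  have hsingle := Finset.single_le_sum key hA
  have hval : splitDist A x y + splitDist A x' y' - splitDist A x x' - splitDist A y y' = 2 := by
    simp only [splitDist, hx, hx', hy, hy']
    norm_num
  rw [hval] at hsingle
  simp only [mul_sub, mul_add, Finset.sum_sub_distrib, Finset.sum_add_distrib] at hsingle
  linarith

theorem exists_splitFun_sum_le {w : Set X → ℝ} (hw : ∀ A, 0 ≤ w A) (hwc : IsWeaklyCompatible w)
    (F : Finset (Set X)) : ∀ f : X → ℝ,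
    (∀ x y, ∑ A ∈ F, w A * splitDist A x y ≤ f x + f y) →
    ∃ t : Set X → ℝ, (∀ A, 0 ≤ t A ∧ t A ≤ w A) ∧ ∀ x, ∑ A ∈ F, splitFun w t x A ≤ f x := by
  classical
  induction F using Finset.induction_on with
  | empty =>
    intro f hf
    refine ⟨fun _ => 0, fun A => ⟨le_rfl, hw A⟩, fun x => ?_⟩
    have := hf x x
    simp only [Finset.sum_empty] at this ⊢
    linarith
  | insert A G hAG ih =>
    intro f hf
    set D : X → X → ℝ := fun x y => ∑ B ∈ insert A G, w B * splitDist B x y with hD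
    have hDG : ∀ x y, ∑ B ∈ G, w B * splitDist B x y = D x y - w A * splitDist A x y := by
      intro x y
      simp [hD, Finset.sum_insert hAG]
    have hcomm : ∀ x y, D x y = D y x := fun x y => by
      simp only [hD, splitDist_comm]
    have hfD : ∀ x y, D x y ≤ f x + f y := hf
    have hcross : ∀ x ∈ A, ∀ x' ∈ A, ∀ y ∉ A, ∀ y' ∉ A, (∀ B ∈ insert A G, 0 < w B →
          ¬((x ∈ B ↔ y ∈ B) ∧ (x' ∈ B ↔ y' ∈ B) ∧ ¬(x ∈ B ↔ x' ∈ B))) →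
        2 * w A + (D x x' + D y y') ≤ D x y + D x' y' := fun x hx x' hx' y hy y' hy' =>
      two_mul_le_of_not_crossing hw _ (Finset.mem_insert_self A G) hx hx' hy hy'
    clear_value D
    clear hf hD
    have hquad : ∀ x ∈ A, ∀ x' ∈ A, ∀ y ∉ A, ∀ y' ∉ A,
        2 * w A ≤ (f x + f x' - D x x') + (f y + f y' - D y y') := by
      intro x hx x' hx' y hy y' hy'
      rcases (hw A).eq_or_lt with h0 | h0
      · linarith [hfD x x', hfD y y']
      by_cases hB : ∀ B ∈ insert A G, 0 < w B →
          ¬((x ∈ B ↔ y ∈ B) ∧ (x' ∈ B ↔ y' ∈ B) ∧ ¬(x ∈ B ↔ x' ∈ B))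
      · linarith [hcross x hx x' hx' y hy y' hy' hB, hfD x y, hfD x' y']
      · simp only [not_forall, not_not, exists_prop] at hB
        obtain ⟨B, -, hB0, hB1⟩ := hB
        have h1 := hcross x hx x' hx' y' hy' y hy
          (fun C _ hC0 hC => hwc A B C h0 hB0 hC0 x x' y y' ⟨hx, hx', hy, hy'⟩ hB1 hC)
        linarith [hfD x y', hfD x' y, hcomm y y']
    obtain ⟨s, hsL, hsU⟩ := exists_between_of_forall_le
      (s := {0} ∪ {r | ∃ y y', y ∉ A ∧ y' ∉ A ∧ r = w A - (f y + f y' - D y y') / 2})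
      (t := {w A} ∪ {r | ∃ x x', x ∈ A ∧ x' ∈ A ∧ r = (f x + f x' - D x x') / 2})
      ⟨0, Or.inl rfl⟩ ⟨w A, Or.inl rfl⟩ (by
        rintro _ (rfl | ⟨y, y', hy, hy', rfl⟩) _ (rfl | ⟨x, x', hx, hx', rfl⟩)
        · exact hw A
        · linarith [hfD x x']
        · linarith [hfD y y']
        · have := hquad x hx x' hx' y hy y' hy'
          linarith)
    have hs0 : 0 ≤ s := hsL (Or.inl rfl)
    have hs1 : s ≤ w A := hsU (Or.inl rfl)
    obtain ⟨t, ht, htf⟩ := ih (fun x => f x - if x ∈ A then s else w A - s) (by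
      intro x y
      rw [hDG]
      have hxy := hfD x y
      by_cases hx : x ∈ A <;> by_cases hy : y ∈ A <;> simp only [hx, hy, splitDist] <;> norm_num
      · have := hsU (Or.inr ⟨x, y, hx, hy, rfl⟩)
        linarith
      · linarith
      · linarith
      · have := hsL (Or.inr ⟨x, y, hx, hy, rfl⟩)
        linarith)
    refine ⟨Function.update t A s, fun B => ?_, fun x => ?_⟩
    · by_cases hBA : B = A
      · subst hBA
        simpa using ⟨hs0, hs1⟩
      · simpa [Function.update_of_ne hBA] using ht B
    · rw [Finset.sum_insert hAG]
      have h1 : ∑ B ∈ G, splitFun w (Function.update t A s) x B = ∑ B ∈ G, splitFun w t x B :=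
        Finset.sum_congr rfl fun B hB => by
          have hBA : B ≠ A := fun h => hAG (h ▸ hB)
          simp [splitFun, Function.update_of_ne hBA]
      have h2 := htf x
      rw [h1]
      simp only [splitFun, Function.update_self] at h2 ⊢
      linarith

theorem splitFun_nonneg {w t : Set X → ℝ} (ht : ∀ A, 0 ≤ t A ∧ t A ≤ w A) (x : X) (A : Set X) :
    0 ≤ splitFun w t x A := by
  unfold splitFun
  split_ifs
  · exact (ht A).1
  · linarith [(ht A).2]

theorem exists_splitFun_forall_sum_le {w : Set X → ℝ} (hw : ∀ A, 0 ≤ w A)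
    (hwc : IsWeaklyCompatible w) (f : X → ℝ)
    (hf : ∀ (F : Finset (Set X)) x y, ∑ A ∈ F, w A * splitDist A x y ≤ f x + f y) :
    ∃ t : Set X → ℝ, (∀ A, 0 ≤ t A ∧ t A ≤ w A) ∧
      ∀ (F : Finset (Set X)) x, ∑ A ∈ F, splitFun w t x A ≤ f x := by
  classical
  have hK : IsCompact (Set.pi univ fun A : Set X => Icc 0 (w A)) :=
    isCompact_univ_pi fun A => isCompact_Icc
  have hcont : ∀ x A, Continuous fun t : Set X → ℝ => splitFun w t x A := by
    intro x A
    unfold splitFun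
    split_ifs <;> fun_prop
  obtain ⟨t, htK, ht⟩ := hK.inter_iInter_nonempty
    (fun F : Finset (Set X) => {t | ∀ x, ∑ A ∈ F, splitFun w t x A ≤ f x})
    (fun F => by
      simp only [ofPred_forall]
      exact isClosed_iInter fun x =>
        isClosed_le (continuous_finsetSum _ fun A _ => hcont x A) continuous_const)
    (fun u => by
      obtain ⟨t, ht, htf⟩ := exists_splitFun_sum_le hw hwc (u.biUnion id) f (hf _)
      refine ⟨t, fun A _ => ht A, ?_⟩
      simp only [mem_iInter]
      intro F hF x
      exact (Finset.sum_le_sum_of_subset_of_nonneg (Finset.subset_biUnion_of_mem id hF)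
        fun A _ _ => splitFun_nonneg ht x A).trans (htf x))
  exact ⟨t, fun A => htK A trivial, fun F => mem_iInter.1 ht F⟩

end Decomposition

section Extremal

open Filter Topology

variable {d : X → X → ℝ}

theorem le_add_of_mem_extSet {f : X → ℝ} (hf : f ∈ ExtSet d) (x y : X) : d x y ≤ f x + f y := by
  have := (hf x).1 ⟨y, rfl⟩
  linarith

theorem nonneg_of_mem_deltaSet (hd : IsPseudometric d) {f : X → ℝ} (hf : f ∈ DeltaSet d) (x : X) :
    0 ≤ f x := by
  have := hf x x
  rw [hd.1] at this
  linarith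

/-- Below any `ℕ`-valued function `v` with `e x y ≤ v x + v y` there is a minimal such function. -/
theorem exists_minimal_nat_le (e : X → X → ℝ) (v : X → ℕ) (hv : ∀ x y, e x y ≤ v x + v y) :
    ∃ u : X → ℕ, u ≤ v ∧ Minimal (fun u : X → ℕ => ∀ x y, e x y ≤ u x + u y) u := by
  obtain ⟨m, hm, hmax⟩ := zorn_le_nonempty₀ (α := (X → ℕ)ᵒᵈ)
    {u | ∀ x y, e x y ≤ (OrderDual.ofDual u x : ℝ) + OrderDual.ofDual u y}
    (fun c hc hchain u₀ hu₀ => by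
      have hatt : ∀ x, ∃ u ∈ c, OrderDual.ofDual u x =
          sInf ((fun u : (X → ℕ)ᵒᵈ => OrderDual.ofDual u x) '' c) := fun x =>
        Nat.sInf_mem (s := (fun u : (X → ℕ)ᵒᵈ => OrderDual.ofDual u x) '' c) ⟨_, u₀, hu₀, rfl⟩
      refine ⟨OrderDual.toDual fun x => sInf ((fun u : (X → ℕ)ᵒᵈ => OrderDual.ofDual u x) '' c),
        fun x y => ?_, fun u hu x => Nat.sInf_le ⟨u, hu, rfl⟩⟩
      obtain ⟨a, ha, hax⟩ := hatt x
      obtain ⟨b, hb, hby⟩ := hatt y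
      simp only [OrderDual.ofDual_toDual]
      rw [← hax, ← hby]
      rcases hchain.total ha hb with hab | hab
      · have h1 : OrderDual.ofDual b x ≤ OrderDual.ofDual a x := hab x
        have h2 := hc hb x y
        have h3 : (OrderDual.ofDual b x : ℝ) ≤ OrderDual.ofDual a x := by exact_mod_cast h1
        linarith
      · have h1 : OrderDual.ofDual a y ≤ OrderDual.ofDual b y := hab y
        have h2 := hc ha x y
        have h3 : (OrderDual.ofDual a y : ℝ) ≤ OrderDual.ofDual b y := by exact_mod_cast h1
        linarith)
    (OrderDual.toDual v) hv
  exact ⟨OrderDual.ofDual m, hm, hmax.1, fun u hu hle => hmax.2 (y := OrderDual.toDual u) hu hle⟩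

theorem exists_add_eq_of_minimal_nat {e : X → X → ℝ} (he0 : ∀ x, e x x = 0)
    (hsymm : ∀ x y, e x y = e y x) (hint : IsIntegerValued e) {u : X → ℕ}
    (hu : Minimal (fun u : X → ℕ => ∀ x y, e x y ≤ u x + u y) u) (x : X) :
    ∃ y, (u x : ℝ) + u y = e x y := by
  classical
  by_contra! hne
  have hstep : ∀ y, e x y + 1 ≤ u x + u y := by
    intro y
    obtain ⟨n, hn⟩ := hint x y
    have h1 := (hu.1 x y).lt_of_ne' (hne y)
    rw [hn] at h1 ⊢
    exact_mod_cast h1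
  have hx : 0 < u x := by
    have := hstep x
    rw [he0] at this
    have h2 : 1 ≤ u x + u x := by exact_mod_cast (zero_add (1 : ℝ)) ▸ this
    omega
  have hcast : ((u x - 1 : ℕ) : ℝ) = u x - 1 := by
    rw [Nat.cast_sub hx, Nat.cast_one]
  have hle := hu.2 (y := Function.update u x (u x - 1)) (by
    intro a b
    by_cases ha : a = x <;> by_cases hb : b = x
    · subst ha hb
      rw [he0]
      positivity
    · subst ha
      have := hstep b
      simp only [Function.update_self, Function.update_of_ne hb, hcast]
      linarith
    · subst hb
      have := hstep a
      rw [hsymm]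
      simp only [Function.update_self, Function.update_of_ne ha, hcast]
      linarith
    · simpa only [Function.update_of_ne ha, Function.update_of_ne hb] using hu.1 a b)
    (fun a => by
      by_cases ha : a = x
      · subst ha; simp
      · simp [Function.update_of_ne ha]) x
  simp only [Function.update_self] at hle
  omega

theorem exists_mem_extSet'_near (hd : IsPseudometric d) (hint : IsIntegerValued d) {f : X → ℝ}
    (hf : f ∈ ExtSet d) {n : ℕ} (hn : 0 < n) :
    ∃ g ∈ ExtSet' d, ∀ x, |f x - g x| ≤ 1 / n := by
  have hn' : (0 : ℝ) < n := by exact_mod_cast hn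
  have hf0 := nonneg_of_mem_deltaSet hd (le_add_of_mem_extSet hf)
  obtain ⟨u, huv, hu⟩ := exists_minimal_nat_le (fun x y => n * d x y) (fun x => ⌈n * f x⌉₊)
    (fun x y => by
      have h1 := Nat.le_ceil (n * f x)
      have h2 := Nat.le_ceil (n * f y)
      have h3 := mul_le_mul_of_nonneg_left (le_add_of_mem_extSet hf x y) hn'.le
      linarith)
  have hg : ∀ x y, d x y ≤ u x / n + u y / n := fun x y => by
    rw [← add_div, le_div_iff₀ hn', mul_comm]
    exact hu.1 x y
  have hgf : ∀ x, u x / n ≤ f x + 1 / n := fun x => by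
    have h1 : (u x : ℝ) ≤ ⌈n * f x⌉₊ := by exact_mod_cast huv x
    have h2 := Nat.ceil_lt_add_one (mul_nonneg hn'.le (hf0 x))
    rw [div_le_iff₀ hn', add_mul, one_div_mul_cancel hn'.ne']
    linarith
  refine ⟨fun x => u x / n, ⟨hg, fun x => ?_⟩, fun x => ?_⟩
  · obtain ⟨y, hy⟩ := exists_add_eq_of_minimal_nat (e := fun x y => n * d x y)
      (fun x => by simp [hd.1]) (fun x y => by simp only [hd.2.1 x y])
      (fun x y => by
        obtain ⟨m, hm⟩ := hint x y
        exact ⟨n * m, by push_cast; rw [hm]⟩) hu x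
    refine ⟨y, ?_⟩
    simp only
    rw [← add_div, hy, mul_div_cancel_left₀ _ hn'.ne']
  · have h1 : f x ≤ u x / n + 1 / n := by
      refine (hf x).2 ?_
      rintro _ ⟨y, rfl⟩
      have := hg x y
      have := hgf y
      linarith
    have := hgf x
    rw [abs_le]
    constructor <;> linarith

theorem cos_two_pi_eq_and_sin_eq_neg {s t : ℝ} {n : ℤ} (h : s + t = n) :
    Real.cos (2 * Real.pi * t) = Real.cos (2 * Real.pi * s) ∧
      Real.sin (2 * Real.pi * t) = -Real.sin (2 * Real.pi * s) := by
  have ht : 2 * Real.pi * t = n * (2 * Real.pi) - 2 * Real.pi * s := by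
    rw [← h]; ring
  rw [ht]
  exact ⟨Real.cos_int_mul_two_pi_sub _ _, Real.sin_int_mul_two_pi_sub _ _⟩

theorem card_le_rank_dirSubmodule (hint : IsIntegerValued d) (g : X → ℝ) {k : ℕ} (p : Fin k → X)
    (hinj : Function.Injective fun i => Real.cos (2 * Real.pi * g (p i)))
    (hsin : ∀ i, Real.sin (2 * Real.pi * g (p i)) ≠ 0) :
    (k : Cardinal) ≤ Module.rank ℝ (dirSubmodule (eqSet d g)) := by
  classical
  let h : Fin k → dirSubmodule (eqSet d g) := fun i =>
    ⟨fun x => if Real.cos (2 * Real.pi * g x) = Real.cos (2 * Real.pi * g (p i)) then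
      Real.sin (2 * Real.pi * g x) else 0, by
      rintro ⟨x, y⟩ hxy
      obtain ⟨n, hn⟩ := hint x y
      have hxy' : g x + g y = d x y := hxy
      obtain ⟨h1, h2⟩ := cos_two_pi_eq_and_sin_eq_neg (hxy'.trans hn)
      simp only [h1, h2]
      split_ifs <;> ring⟩
  have hli : LinearIndependent ℝ h := by
    rw [Fintype.linearIndependent_iff]
    intro c hc i
    have h1 := congrFun (congrArg Subtype.val hc) (p i)
    rw [AddSubmonoidClass.coe_finsetSum, Finset.sum_apply, Finset.sum_eq_single i] at h1
    · simpa [h, hsin i] using h1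
    · intro j _ hj
      have : Real.cos (2 * Real.pi * g (p i)) ≠ Real.cos (2 * Real.pi * g (p j)) :=
        fun he => hj (hinj he).symm
      simp [h, this]
    · simp
  simpa using hli.cardinal_lift_le_rank

theorem finite_range_cos (hd : IsPseudometric d) (hint : IsIntegerValued d) (hlrc : LRC d)
    {f : X → ℝ} (hf : f ∈ ExtSet d) : (range fun x => Real.cos (2 * Real.pi * f x)).Finite := by
  by_contra hinf
  obtain ⟨ε, hε, N, hN⟩ := hlrc f hf
  have hinf' : ((range fun x => Real.cos (2 * Real.pi * f x)) \ {1, -1}).Infinite :=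
    Set.Infinite.sdiff hinf (by simp)
  let v : Fin (N + 1) → ℝ := fun i => hinf'.natEmbedding _ i
  have hvinj : Function.Injective v := fun i j hij =>
    Fin.ext ((hinf'.natEmbedding _).injective (Subtype.ext hij))
  have hv : ∀ i, v i ∈ (range fun x => Real.cos (2 * Real.pi * f x)) \ {1, -1} :=
    fun i => (hinf'.natEmbedding _ i).2
  choose p hp using fun i => (hv i).1
  have hsin : ∀ i, Real.sin (2 * Real.pi * f (p i)) ≠ 0 := by
    intro i h0
    rw [Real.sin_eq_zero_iff_cos_eq] at h0
    exact (hv i).2 (by simpa [← hp i] using h0)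
  choose g hg hfg using fun n : ℕ => exists_mem_extSet'_near hd hint hf n.succ_pos
  have hlim0 : Tendsto (fun n : ℕ => (1 : ℝ) / ((n + 1 : ℕ) : ℝ)) atTop (𝓝 0) := by
    simpa using tendsto_one_div_add_atTop_nhds_zero_nat (𝕜 := ℝ)
  have hlim : ∀ x, Tendsto (fun n => 2 * Real.pi * g n x) atTop (𝓝 (2 * Real.pi * f x)) := by
    intro x
    refine Tendsto.const_mul _ (tendsto_iff_dist_tendsto_zero.2 ?_)
    refine squeeze_zero (fun _ => dist_nonneg) (fun n => ?_) hlim0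
    rw [dist_comm, Real.dist_eq]
    exact hfg n x
  have hcos : ∀ x, Tendsto (fun n => Real.cos (2 * Real.pi * g n x)) atTop
      (𝓝 (Real.cos (2 * Real.pi * f x))) := fun x =>
    (Real.continuous_cos.tendsto _).comp (hlim x)
  have hev1 : ∀ᶠ n in atTop, ∀ i, Real.sin (2 * Real.pi * g n (p i)) ≠ 0 :=
    eventually_all.2 fun i =>
      ((Real.continuous_sin.tendsto _).comp (hlim (p i))).eventually_ne (hsin i)
  have hev2 : ∀ᶠ n in atTop, ∀ i j, i ≠ j →
      Real.cos (2 * Real.pi * g n (p i)) ≠ Real.cos (2 * Real.pi * g n (p j)) := by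
    refine eventually_all.2 fun i => eventually_all.2 fun j => ?_
    by_cases hij : i = j
    · simp [hij]
    · have hne : Real.cos (2 * Real.pi * f (p i)) ≠ Real.cos (2 * Real.pi * f (p j)) := by
        have h1 := hp i
        have h2 := hp j
        simp only at h1 h2
        rw [h1, h2]
        exact hvinj.ne hij
      exact (((hcos (p i)).sub (hcos (p j))).eventually_ne (sub_ne_zero.2 hne)).mono
        fun n hn _ => sub_ne_zero.1 hn
  obtain ⟨n, hn1, hn2, hn3⟩ :=
    (hev1.and (hev2.and (hlim0.eventually (gt_mem_nhds hε)))).exists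
  have hle := (card_le_rank_dirSubmodule hint (g n) p
    (fun i j hij => by_contra fun hne => hn2 i j hne hij) hn1).trans
    (hN (g n) (hg n) fun x => (hfg n x).trans_lt hn3)
  have : N + 1 ≤ N := by exact_mod_cast hle
  omega

theorem finite_range_cos_add (f : X → ℝ)
    (hf : (range fun x => Real.cos (2 * Real.pi * f x)).Finite) (a : ℝ) :
    (range fun x => Real.cos (2 * Real.pi * (a + f x))).Finite := by
  refine ((hf.prod (Set.toFinite ({1, -1} : Set ℝ))).image fun q : ℝ × ℝ =>
    Real.cos (2 * Real.pi * a) * q.1 -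
      Real.sin (2 * Real.pi * a) * (q.2 * √(1 - q.1 ^ 2))).subset ?_
  rintro _ ⟨x, rfl⟩
  have habs := Real.abs_sin_eq_sqrt_one_sub_cos_sq (2 * Real.pi * f x)
  simp only [mul_add, Real.cos_add]
  rcases abs_choice (Real.sin (2 * Real.pi * f x)) with h | h
  · exact ⟨(Real.cos (2 * Real.pi * f x), 1), ⟨⟨x, rfl⟩, by simp⟩,
      by simp only; rw [← habs, h, one_mul]⟩
  · exact ⟨(Real.cos (2 * Real.pi * f x), -1), ⟨⟨x, rfl⟩, by simp⟩,
      by simp only; rw [← habs, h]; ring⟩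

/-- For an integer-valued metric with the local rank condition, `E(X, d) ⊆ E'(X, d)`. -/
theorem extSet_subset_extSet' (hd : IsPseudometric d) (hint : IsIntegerValued d) (hlrc : LRC d) :
    ExtSet d ⊆ ExtSet' d := by
  intro f hf
  refine ⟨le_add_of_mem_extSet hf, fun x => ?_⟩
  have hfin := (finite_range_cos_add f (finite_range_cos hd hint hlrc hf) (f x)).sdiff (t := {1})
  have hnear : ∀ᶠ r : ℝ in 𝓝 0, Real.cos (2 * Real.pi * r) ∉
      (range fun y => Real.cos (2 * Real.pi * (f x + f y))) \ {1} := by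
    have hc : Continuous fun r : ℝ => Real.cos (2 * Real.pi * r) := by fun_prop
    exact (hc.tendsto 0).eventually (hfin.isClosed.isOpen_compl.mem_nhds (by simp))
  obtain ⟨ε, hε, hball⟩ := Metric.eventually_nhds_iff.1 hnear
  obtain ⟨_, ⟨y, rfl⟩, hy, -⟩ := (hf x).exists_between (sub_lt_self (f x) (lt_min hε one_pos))
  refine ⟨y, ?_⟩
  obtain ⟨n, hn⟩ := hint x y
  have hr0 := le_add_of_mem_extSet hf x y
  have hmin1 := min_le_left ε 1
  have hmin2 := min_le_right ε 1
  set r := f x + f y - d x y with hr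
  have hcos : Real.cos (2 * Real.pi * r) = Real.cos (2 * Real.pi * (f x + f y)) := by
    rw [hr, hn, show 2 * Real.pi * (f x + f y - n) = 2 * Real.pi * (f x + f y) - n * (2 * Real.pi)
      by ring, Real.cos_sub_int_mul_two_pi]
  have h1 := hball (y := r) (by
    rw [Real.dist_eq, sub_zero, abs_of_nonneg (by linarith)]
    linarith)
  have h2 : Real.cos (2 * Real.pi * r) = 1 := by
    by_contra hne
    exact h1 ⟨⟨y, hcos.symm⟩, hne⟩
  obtain ⟨k, hk⟩ := (Real.cos_eq_one_iff _).1 h2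
  have hkr : (k : ℝ) = r := by
    have := Real.two_pi_pos.ne'
    field_simp at hk
    linarith
  have hk0 : (0 : ℝ) ≤ k := by linarith
  have hk1 : (k : ℝ) < 1 := by linarith
  have hk0' : 0 ≤ k := by exact_mod_cast hk0
  have hk1' : k < 1 := by exact_mod_cast hk1
  have : k = 0 := by omega
  rw [this, Int.cast_zero] at hkr
  linarith

end Extremal

section IsolationIndex

variable {d : X → X → ℝ}

theorem betaIdx_nonneg (d : X → X → ℝ) (a a' b b' : X) : 0 ≤ betaIdx d a a' b b' := by
  have := le_max_right (max (d a b + d a' b') (d a' b + d a b')) (d a a' + d b b')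
  unfold betaIdx
  linarith

theorem isolIdx_nonneg (d : X → X → ℝ) (A B : Set X) : 0 ≤ isolIdx d A B := by
  refine Real.sInf_nonneg ?_
  rintro _ ⟨a, -, a', -, b, -, b', -, rfl⟩
  exact betaIdx_nonneg d a a' b b'

theorem isolIdx_le_betaIdx {A B : Set X} {a a' b b' : X} (ha : a ∈ A) (ha' : a' ∈ A) (hb : b ∈ B)
    (hb' : b' ∈ B) : isolIdx d A B ≤ betaIdx d a a' b b' := by
  refine csInf_le ⟨0, ?_⟩ ⟨a, ha, a', ha', b, hb, b', hb', rfl⟩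
  rintro _ ⟨a, -, a', -, b, -, b', -, rfl⟩
  exact betaIdx_nonneg d a a' b b'

theorem betaIdx_comm (hsymm : ∀ x y, d x y = d y x) (a a' b b' : X) :
    betaIdx d a a' b b' = betaIdx d b b' a a' := by
  unfold betaIdx
  rw [hsymm b a, hsymm b' a', hsymm b' a, hsymm b a', add_comm (d a' b) (d a b'),
    add_comm (d b b') (d a a')]
  ring

theorem isolIdx_comm (hsymm : ∀ x y, d x y = d y x) (A B : Set X) :
    isolIdx d A B = isolIdx d B A := by
  unfold isolIdx
  congr 1
  ext r
  constructor
  · rintro ⟨a, ha, a', ha', b, hb, b', hb', rfl⟩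
    exact ⟨b, hb, b', hb', a, ha, a', ha', betaIdx_comm hsymm _ _ _ _⟩
  · rintro ⟨a, ha, a', ha', b, hb, b', hb', rfl⟩
    exact ⟨b, hb, b', hb', a, ha, a', ha', betaIdx_comm hsymm _ _ _ _⟩

theorem IsDSplit.compl (hsymm : ∀ x y, d x y = d y x) {A : Set X} (h : IsDSplit d A Aᶜ) :
    IsDSplit d Aᶜ Aᶜᶜ := by
  rw [compl_compl]
  exact ⟨⟨⟨h.1.1.2.1, h.1.1.1, h.1.1.2.2.symm⟩, by rw [union_comm]; exact h.1.2⟩,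
    isolIdx_comm hsymm A Aᶜ ▸ h.2⟩

theorem isDSplit_compl_iff (hsymm : ∀ x y, d x y = d y x) {A : Set X} :
    IsDSplit d Aᶜ Aᶜᶜ ↔ IsDSplit d A Aᶜ :=
  ⟨fun h => by simpa using h.compl hsymm, fun h => h.compl hsymm⟩

theorem IsDSplit.add_lt_max {A : Set X} (h : IsDSplit d A Aᶜ) {a a' b b' : X} (ha : a ∈ A)
    (ha' : a' ∈ A) (hb : b ∉ A) (hb' : b' ∉ A) :
    d a a' + d b b' < max (d a b + d a' b') (d a' b + d a b') := by
  have h1 := h.2.trans_le (isolIdx_le_betaIdx (d := d) (B := Aᶜ) ha ha' hb hb')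
  unfold betaIdx at h1
  rcases max_cases (max (d a b + d a' b') (d a' b + d a b')) (d a a' + d b b') with h2 | h2 <;>
    linarith

theorem IsDSplit.add_lt_max_of_iff (hsymm : ∀ x y, d x y = d y x) {A : Set X}
    (h : IsDSplit d A Aᶜ) {a a' b b' : X} (ha : a ∈ A ↔ a' ∈ A) (hb : b ∈ A ↔ b' ∈ A)
    (hab : ¬(a ∈ A ↔ b ∈ A)) :
    d a a' + d b b' < max (d a b + d a' b') (d a b' + d a' b) := by
  by_cases h0 : a ∈ A
  · have hbA : b ∉ A := fun hbA => hab (by simp [h0, hbA])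
    have := h.add_lt_max h0 (ha.1 h0) hbA (fun hb' => hbA (hb.2 hb'))
    rwa [add_comm (d a' b)] at this
  · have hbA : b ∈ A := by_contra fun hbA => hab (by simp [h0, hbA])
    have := h.add_lt_max hbA (hb.1 hbA) h0 (fun ha' => h0 (ha.2 ha'))
    rwa [hsymm b a, hsymm b' a', hsymm b' a, hsymm b a', add_comm (d b b')] at this

open Classical in
/-- Half the isolation index on the parts of `d`-splits, and `0` elsewhere. -/
def splitWeight (d : X → X → ℝ) (A : Set X) : ℝ :=
  if IsDSplit d A Aᶜ then isolIdx d A Aᶜ / 2 else 0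

theorem splitWeight_of_isDSplit {A : Set X} (h : IsDSplit d A Aᶜ) :
    splitWeight d A = isolIdx d A Aᶜ / 2 := if_pos h

theorem splitWeight_nonneg (d : X → X → ℝ) (A : Set X) : 0 ≤ splitWeight d A := by
  unfold splitWeight
  split_ifs
  · exact div_nonneg (isolIdx_nonneg d A Aᶜ) two_pos.le
  · exact le_rfl

theorem splitWeight_compl (hsymm : ∀ x y, d x y = d y x) (A : Set X) :
    splitWeight d Aᶜ = splitWeight d A := by
  unfold splitWeight
  rw [isDSplit_compl_iff hsymm, compl_compl, isolIdx_comm hsymm]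

theorem isDSplit_of_splitWeight_pos {A : Set X} (h : 0 < splitWeight d A) : IsDSplit d A Aᶜ := by
  by_contra hA
  simp [splitWeight, hA] at h

theorem isWeaklyCompatible_splitWeight (hsymm : ∀ x y, d x y = d y x) :
    IsWeaklyCompatible (splitWeight d) := by
  rintro A B C hA hB hC x x' y y' ⟨hx, hx', hy, hy'⟩ ⟨hB1, hB2, hB3⟩ ⟨hC1, hC2, hC3⟩
  have h1 := (isDSplit_of_splitWeight_pos hA).add_lt_max hx hx' hy hy'
  have h2 := (isDSplit_of_splitWeight_pos hB).add_lt_max_of_iff hsymm hB1 hB2 hB3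
  have h3 := (isDSplit_of_splitWeight_pos hC).add_lt_max_of_iff hsymm hC1 hC2 hC3
  rw [hsymm y x', hsymm y y'] at *
  rw [hsymm y' x', hsymm y' y] at *
  simp only [lt_max_iff] at h1 h2 h3
  rcases h1 with h1 | h1 <;> rcases h2 with h2 | h2 <;> rcases h3 with h3 | h3 <;>
    linarith [hsymm y y']

end IsolationIndex

section TotallySplitDecomposable

variable {d : X → X → ℝ}

/-- The parts containing `x` but not `y` of the `d`-splits. -/
def separatingParts (d : X → X → ℝ) (x y : X) : Set (Set X) :=
  {A | IsDSplit d A Aᶜ ∧ x ∈ A ∧ y ∉ A}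

theorem finite_separatingParts (hmet : IsMetric d) (hTSD : TSD d) (x y : X) :
    (separatingParts d x y).Finite := by
  by_cases hxy : x = y
  · subst hxy
    exact Set.finite_empty.subset fun A hA => hA.2.2 hA.2.1
  · by_contra hinf
    refine hxy (hmet.2 x y ?_)
    rw [hTSD x y]
    refine finsum_mem_eq_zero_of_infinite (Set.Infinite.mono ?_ hinf)
    exact fun A hA => ⟨hA, hA.1.2.ne'⟩

theorem sum_separatingParts (hmet : IsMetric d) (hTSD : TSD d) (x y : X) :
    ∑ A ∈ (finite_separatingParts hmet hTSD x y).toFinset, splitWeight d A = d x y / 2 := by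
  rw [hTSD x y, ← separatingParts,
    finsum_mem_eq_finite_toFinset_sum _ (finite_separatingParts hmet hTSD x y), Finset.sum_div]
  exact Finset.sum_congr rfl fun A hA =>
    splitWeight_of_isDSplit ((Set.Finite.mem_toFinset _).1 hA).1

theorem disjoint_separatingParts (hmet : IsMetric d) (hTSD : TSD d) (x y : X) :
    Disjoint (finite_separatingParts hmet hTSD x y).toFinset
      (finite_separatingParts hmet hTSD y x).toFinset := by
  rw [Finset.disjoint_left]
  intro A hA hA'
  exact ((Set.Finite.mem_toFinset _).1 hA').2.2 ((Set.Finite.mem_toFinset _).1 hA).2.1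

open Classical in
/-- The parts of the `d`-splits separating `x` from `y`. -/
def separatingFinset (hmet : IsMetric d) (hTSD : TSD d) (x y : X) : Finset (Set X) :=
  (finite_separatingParts hmet hTSD x y).toFinset ∪ (finite_separatingParts hmet hTSD y x).toFinset

theorem mem_separatingFinset {hmet : IsMetric d} {hTSD : TSD d} {x y : X} {A : Set X} :
    A ∈ separatingFinset hmet hTSD x y ↔ IsDSplit d A Aᶜ ∧ ¬(x ∈ A ↔ y ∈ A) := by
  simp only [separatingFinset, Finset.mem_union, Set.Finite.mem_toFinset, separatingParts,
    Set.mem_ofPred_eq]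
  tauto

theorem sum_separatingFinset (hmet : IsMetric d) (hTSD : TSD d) (x y : X) :
    ∑ A ∈ separatingFinset hmet hTSD x y, splitWeight d A = d x y := by
  classical
  have h := Finset.sum_union (f := splitWeight d) (disjoint_separatingParts hmet hTSD x y)
  rw [sum_separatingParts hmet hTSD, sum_separatingParts hmet hTSD, hmet.1.2.1 y x, add_halves] at h
  rw [← h]
  unfold separatingFinset
  congr

theorem sum_splitWeight_mul_splitDist_le (hmet : IsMetric d) (hTSD : TSD d) (F : Finset (Set X))
    (x y : X) : ∑ A ∈ F, splitWeight d A * splitDist A x y ≤ d x y := by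
  classical
  rw [← sum_separatingFinset hmet hTSD x y,
    ← Finset.sum_filter_add_sum_filter_not F (· ∈ separatingFinset hmet hTSD x y)]
  have h0 : ∑ A ∈ F with A ∉ separatingFinset hmet hTSD x y,
      splitWeight d A * splitDist A x y = 0 := by
    refine Finset.sum_eq_zero fun A hA => ?_
    have hA' := (Finset.mem_filter.1 hA).2
    rw [mem_separatingFinset, not_and, not_not] at hA'
    by_cases hd : IsDSplit d A Aᶜ
    · simp [splitDist, hA' hd]
    · simp [splitWeight, hd]
  rw [h0, add_zero]
  refine (Finset.sum_le_sum (g := splitWeight d) fun A _ => ?_).trans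
    (Finset.sum_le_sum_of_subset_of_nonneg (fun A hA => (Finset.mem_filter.1 hA).2)
      fun A _ _ => splitWeight_nonneg d A)
  have : splitDist A x y ≤ 1 := by
    unfold splitDist
    split_ifs <;> norm_num
  exact mul_le_of_le_one_right (splitWeight_nonneg d A) this

end TotallySplitDecomposable

section Kappa

theorem dOne_le_ofReal {𝒮 : Set (Set X)} {μ ψ : Set X → ℝ} {c : ℝ}
    (h : ∀ F : Finset (Set X), (∀ A ∈ F, A ∈ 𝒮) → ∑ A ∈ F, |μ A - ψ A| ≤ c) :
    dOne 𝒮 μ ψ ≤ ENNReal.ofReal c := by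
  unfold dOne
  rw [ENNReal.tsum_eq_iSup_sum]
  refine iSup_le fun F => ?_
  rw [← ENNReal.ofReal_sum_of_nonneg fun _ _ => abs_nonneg _]
  refine ENNReal.ofReal_le_ofReal ?_
  have := h (F.map (Function.Embedding.subtype _)) (by simp +contextual)
  rwa [Finset.sum_map] at this

theorem sum_le_toReal_dOne {𝒮 : Set (Set X)} {μ ψ : Set X → ℝ} (hfin : dOne 𝒮 μ ψ ≠ ⊤)
    {F : Finset (Set X)} (hF : ∀ A ∈ F, A ∈ 𝒮) :
    ∑ A ∈ F, |μ A - ψ A| ≤ (dOne 𝒮 μ ψ).toReal := by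
  classical
  rw [← ENNReal.ofReal_le_iff_le_toReal hfin,
    ENNReal.ofReal_sum_of_nonneg fun _ _ => abs_nonneg _,
    ← Finset.sum_subtype_of_mem (p := (· ∈ 𝒮)) (fun A => ENNReal.ofReal |μ A - ψ A|) hF]
  exact ENNReal.sum_le_tsum _

variable {d : X → X → ℝ}

theorem splitWeight_le_abs_add_abs {A : Set X} (hA : IsDSplit d A Aᶜ) (μ : Set X → ℝ) {x y : X}
    (hxy : ¬(x ∈ A ↔ y ∈ A)) :
    splitWeight d A ≤ |μ A - phiPoint (fun A => isolIdx d A Aᶜ) x A| +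
      |μ A - phiPoint (fun A => isolIdx d A Aᶜ) y A| := by
  rw [splitWeight_of_isDSplit hA]
  simp only [phiPoint]
  have h1 := le_abs_self (μ A)
  have h2 := neg_abs_le (μ A - isolIdx d A Aᶜ / 2)
  by_cases hx : x ∈ A <;> by_cases hy : y ∈ A <;> simp only [hx, hy, not_true] at hxy <;>
    simp only [hx, hy, if_true, if_false, sub_zero] <;> linarith

theorem le_toReal_dOne_add (hmet : IsMetric d) (hTSD : TSD d) {μ : Set X → ℝ}
    (hfin : ∀ x, dOne {A | IsDSplit d A Aᶜ} μ (phiPoint (fun A => isolIdx d A Aᶜ) x) ≠ ⊤)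
    (x y : X) :
    d x y ≤ (dOne {A | IsDSplit d A Aᶜ} μ (phiPoint (fun A => isolIdx d A Aᶜ) x)).toReal +
      (dOne {A | IsDSplit d A Aᶜ} μ (phiPoint (fun A => isolIdx d A Aᶜ) y)).toReal := by
  have hF : ∀ A ∈ separatingFinset hmet hTSD x y, A ∈ {A : Set X | IsDSplit d A Aᶜ} :=
    fun A hA => (mem_separatingFinset.1 hA).1
  refine le_trans ?_ (add_le_add (sum_le_toReal_dOne (hfin x) hF) (sum_le_toReal_dOne (hfin y) hF))
  rw [← sum_separatingFinset hmet hTSD x y, ← Finset.sum_add_distrib]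
  refine Finset.sum_le_sum fun A hA => ?_
  obtain ⟨h1, h2⟩ := mem_separatingFinset.1 hA
  exact splitWeight_le_abs_add_abs h1 μ h2

theorem lt_toReal_dOne_add (hmet : IsMetric d) (hTSD : TSD d) {μ : Set X → ℝ}
    (hfin : ∀ x, dOne {A | IsDSplit d A Aᶜ} μ (phiPoint (fun A => isolIdx d A Aᶜ) x) ≠ ⊤)
    {x y : X} {A : Set X} (hA : IsDSplit d A Aᶜ) (hμ : 0 < μ A) (hx : x ∈ A) (hy : y ∈ A) :
    d x y < (dOne {A | IsDSplit d A Aᶜ} μ (phiPoint (fun A => isolIdx d A Aᶜ) x)).toReal +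
      (dOne {A | IsDSplit d A Aᶜ} μ (phiPoint (fun A => isolIdx d A Aᶜ) y)).toReal := by
  classical
  have hAF : A ∉ separatingFinset hmet hTSD x y := fun h =>
    (mem_separatingFinset.1 h).2 (by simp [hx, hy])
  have hF : ∀ B ∈ insert A (separatingFinset hmet hTSD x y), B ∈ {A : Set X | IsDSplit d A Aᶜ} := by
    intro B hB
    rcases Finset.mem_insert.1 hB with rfl | hB
    · exact hA
    · exact (mem_separatingFinset.1 hB).1
  refine lt_of_lt_of_le ?_
    (add_le_add (sum_le_toReal_dOne (hfin x) hF) (sum_le_toReal_dOne (hfin y) hF))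
  rw [← sum_separatingFinset hmet hTSD x y, ← Finset.sum_add_distrib, Finset.sum_insert hAF]
  refine lt_add_of_pos_of_le ?_ (Finset.sum_le_sum fun B hB => ?_)
  · simp only [phiPoint, hx, hy, if_true, sub_zero]
    have := abs_pos.2 hμ.ne'
    linarith
  · obtain ⟨h1, h2⟩ := mem_separatingFinset.1 hB
    exact splitWeight_le_abs_add_abs h1 μ h2

theorem memT_of_mem_extSet' (hmet : IsMetric d) (hTSD : TSD d) {f : X → ℝ} (hf : f ∈ ExtSet' d)
    {μ : Set X → ℝ} (hμ : memH {A : Set X | IsDSplit d A Aᶜ} (fun A => isolIdx d A Aᶜ) μ)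
    (hκ : ∀ x, dOne {A | IsDSplit d A Aᶜ} μ (phiPoint (fun A => isolIdx d A Aᶜ) x)
      = ENNReal.ofReal (f x)) :
    memT {A : Set X | IsDSplit d A Aᶜ} (fun A => isolIdx d A Aᶜ) μ := by
  refine ⟨hμ, fun I hI hcover => Set.eq_empty_iff_forall_notMem.2 fun x hx => ?_⟩
  obtain ⟨y, hy⟩ := hf.2 x
  obtain ⟨A, hAI, hyA⟩ : y ∈ ⋃₀ I := hcover ▸ mem_univ y
  have hf0 := nonneg_of_mem_deltaSet hmet.1 hf.1
  have hlt := lt_toReal_dOne_add hmet hTSD (μ := μ) (fun x => by simp [hκ x]) (hI hAI).1 (hI hAI).2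
    (hx A hAI) hyA
  rw [hκ, hκ, ENNReal.toReal_ofReal (hf0 x), ENNReal.toReal_ofReal (hf0 y), hy] at hlt
  exact hlt.false

theorem exists_memH_dOne_le (hmet : IsMetric d) (hTSD : TSD d) {f : X → ℝ} (hf : f ∈ DeltaSet d) :
    ∃ μ : Set X → ℝ, memH {A : Set X | IsDSplit d A Aᶜ} (fun A => isolIdx d A Aᶜ) μ ∧
      ∀ x, dOne {A | IsDSplit d A Aᶜ} μ (phiPoint (fun A => isolIdx d A Aᶜ) x)
        ≤ ENNReal.ofReal (f x) := by
  classical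
  have hsymm := hmet.1.2.1
  obtain ⟨t, ht, htf⟩ := exists_splitFun_forall_sum_le (splitWeight_nonneg d)
    (isWeaklyCompatible_splitWeight hsymm) f
    (fun F x y => (sum_splitWeight_mul_splitDist_le hmet hTSD F x y).trans (hf x y))
  have hwc := splitWeight_compl (d := d) hsymm
  refine ⟨fun A => (t A + splitWeight d A - t Aᶜ) / 2, ⟨fun A _ => ?_, fun A hA => ?_⟩,
    fun x => dOne_le_ofReal fun F hF => ?_⟩
  · have h1 := (ht A).1
    have h2 := (ht Aᶜ).2
    rw [hwc] at h2
    linarith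
  · simp only [hwc, compl_compl]
    rw [← splitWeight_of_isDSplit hA]
    ring
  · have hterm : ∀ A ∈ F, |(t A + splitWeight d A - t Aᶜ) / 2 -
        phiPoint (fun A => isolIdx d A Aᶜ) x A| =
        (splitFun (splitWeight d) t x A + splitFun (splitWeight d) t x Aᶜ) / 2 := by
      intro A hA
      have h1 := ht A
      have h2 := ht Aᶜ
      simp only [phiPoint, splitFun, mem_compl_iff, hwc] at h2 ⊢
      rw [← splitWeight_of_isDSplit (hF A hA)]
      by_cases hx : x ∈ A
      · simp only [hx, if_true, not_true, if_false]
        rw [abs_of_nonneg (by linarith)]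
        ring
      · simp only [hx, not_false_iff, if_true, if_false]
        rw [abs_of_nonpos (by linarith)]
        ring
    have h1 := htf F x
    have h2 := htf (F.map ⟨compl, compl_injective⟩) x
    rw [Finset.sum_map] at h2
    rw [Finset.sum_congr rfl hterm, ← Finset.sum_div, Finset.sum_add_distrib]
    simp only [Function.Embedding.coeFn_mk] at h2
    linarith

end Kappa

theorem statement13 (d : X → X → ℝ) (hmet : IsMetric d) (hint : IsIntegerValued d)
    (hlrc : LRC d) (hTSD : TSD d) (f : X → ℝ) (hf : f ∈ ExtSet d) :
    ∃ μ : Set X → ℝ,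
      memT {A : Set X | IsDSplit d A Aᶜ} (fun A => isolIdx d A Aᶜ) μ ∧
      ∀ x, dOne {A : Set X | IsDSplit d A Aᶜ} μ (phiPoint (fun A => isolIdx d A Aᶜ) x)
        = ENNReal.ofReal (f x) := by
  have hf' := extSet_subset_extSet' hmet.1 hint hlrc hf
  obtain ⟨μ, hμ, hle⟩ := exists_memH_dOne_le hmet hTSD hf'.1
  have hfin : ∀ x, dOne {A : Set X | IsDSplit d A Aᶜ} μ
      (phiPoint (fun A => isolIdx d A Aᶜ) x) ≠ ⊤ := fun x =>
    ne_top_of_le_ne_top ENNReal.ofReal_ne_top (hle x)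
  have hf0 := nonneg_of_mem_deltaSet hmet.1 hf'.1
  have hκ : ∀ x, dOne {A : Set X | IsDSplit d A Aᶜ} μ (phiPoint (fun A => isolIdx d A Aᶜ) x)
      = ENNReal.ofReal (f x) := by
    refine fun x => le_antisymm (hle x) (ENNReal.ofReal_le_of_le_toReal ((hf x).2 ?_))
    rintro _ ⟨y, rfl⟩
    have h1 := le_toReal_dOne_add hmet hTSD hfin x y
    have h2 := ENNReal.toReal_le_of_le_ofReal (hf0 y) (hle y)
    linarith
  exact ⟨μ, memT_of_mem_extSet' hmet hTSD hf' hμ hκ, hκ⟩
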